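/- arXiv:2402.19056 — 8 statements merged into one kernel-verified Lean document; each statement's English description precedes it below -/
import Mathlib

section
/- Let 0 < ε < 1, let γ ∈ ℝ, and let x ∈ ℝ satisfy 1 − 2/ln(ε) < x ≤ γ. Then ε^x·|1 + (x−1)·ln(ε)| > ε^γ; that is, the absolute value of the derivative f_ε'(x) of f_ε at x is strictly greater than ε^γ. -/
open Real

/-- For `0 < ε < 1` and `1 - 2/ln ε < x ≤ γ`, the absolute value of the derivative
of `f_ε` at `x`, namely `ε^x·|1 + (x-1)·ln ε|`, is strictly greater than `ε^γ`. -/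
theorem abs_deriv_f_eps_gt (ε γ x : ℝ) (hε0 : 0 < ε) (hε1 : ε < 1)
    (hx : 1 - 2 / Real.log ε < x) (hxγ : x ≤ γ) :
    ε ^ γ < ε ^ x * |1 + (x - 1) * Real.log ε| := by
  have hL : Real.log ε < 0 := Real.log_neg hε0 hε1
  have h1 : (x - 1) * Real.log ε < -2 := by
    have h2 : -2 / Real.log ε < x - 1 := by
      rw [neg_div]; linarith
    exact (div_lt_iff_of_neg hL).mp h2
  have h3 : 1 < |1 + (x - 1) * Real.log ε| := by
    rw [abs_of_neg (by linarith)]; linarith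
  have h4 : ε ^ γ ≤ ε ^ x := Real.rpow_le_rpow_of_exponent_ge hε0 hε1.le hxγ
  have h5 : 0 < ε ^ x := Real.rpow_pos_of_pos hε0 x
  nlinarith
end

section
/- Let 0 < ε < 1 and let α, γ be real numbers with α > 1 − 2/ln(ε) and γ > 1 − 2/ln(ε). Then |γ − α| ≤ ε^(−max(α,γ))·|(γ−1)·ε^γ − (α−1)·ε^α|. -/
open Real

theorem key_aux (ε α γ : ℝ) (hε0 : 0 < ε) (hε1 : ε < 1)
    (hα : 1 - 2 / Real.log ε < α) (h : α ≤ γ) :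
    γ - α ≤ ε ^ (-γ) * ((α - 1) * ε ^ α - (γ - 1) * ε ^ γ) := by
  have hL : Real.log ε < 0 := Real.log_neg hε0 hε1
  have h1 : ε ^ (-γ) * ε ^ γ = 1 := by
    rw [← Real.rpow_add hε0]; simp
  have h2 : ε ^ (-γ) * ε ^ α = Real.exp (Real.log ε * (α - γ)) := by
    rw [← Real.rpow_add hε0, Real.rpow_def_of_pos hε0]; ring_nf
  have h3 := Real.add_one_le_exp (Real.log ε * (α - γ))
  have h4 : 2 ≤ (α - 1) * (-Real.log ε) := by
    have h5 : 2 / (-Real.log ε) < α - 1 := by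
      rw [div_neg]; linarith
    rw [div_lt_iff₀ (by linarith)] at h5
    exact h5.le
  have h6 : 0 < α - 1 := by
    by_contra hc
    nlinarith
  have h7 : ε ^ (-γ) * ((α - 1) * ε ^ α - (γ - 1) * ε ^ γ)
      = (α - 1) * Real.exp (Real.log ε * (α - γ)) - (γ - 1) := by
    rw [← h2]; linear_combination (-(γ - 1)) * h1
  rw [h7]
  have h8 := mul_le_mul_of_nonneg_left h3 h6.le
  have h9 := mul_le_mul_of_nonneg_right h4 (sub_nonneg.2 h)
  linarith

/-- For `0 < ε < 1` and `α, γ > 1 - 2/ln ε`, one has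
`|γ - α| ≤ ε^(-max(α,γ)) · |(γ-1)·ε^γ - (α-1)·ε^α|`. -/
theorem abs_sub_le_rpow_mul_abs_f_eps_sub (ε α γ : ℝ) (hε0 : 0 < ε) (hε1 : ε < 1)
    (hα : 1 - 2 / Real.log ε < α) (hγ : 1 - 2 / Real.log ε < γ) :
    |γ - α| ≤ ε ^ (-(max α γ)) * |(γ - 1) * ε ^ γ - (α - 1) * ε ^ α| := by
  rcases le_total α γ with h | h
  · rw [max_eq_right h, abs_of_nonneg (sub_nonneg.2 h), abs_sub_comm]
    exact (key_aux ε α γ hε0 hε1 hα h).trans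
      (mul_le_mul_of_nonneg_left (le_abs_self _) (Real.rpow_pos_of_pos hε0 _).le)
  · rw [max_eq_left h, abs_sub_comm γ α, abs_of_nonneg (sub_nonneg.2 h)]
    exact (key_aux ε γ α hε0 hε1 hγ h).trans
      (mul_le_mul_of_nonneg_left (le_abs_self _) (Real.rpow_pos_of_pos hε0 _).le)
end

section
/- Let γ > 1, τ₀ > 0, T ≥ 0, c > 0, D ≥ 0 be real numbers. Let 0 < ε < 1 satisfy ε ≥ c·(τ₀+T)^(−1/(γ−1)), and let α be a real number with 1 − 2/ln(ε) < α ≤ γ. If |(γ−1)·ε^γ − (α−1)·ε^α| ≤ D·(1+T)^(−(2 + 1/(γ−1))), then |γ − α| ≤ (D/c^γ)·(max(τ₀,1))^(γ/(γ−1))·(1+T)^(−1). -/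
open Real

/-- Quantitative core of the stability estimate for recovering the polytropic
exponent `γ` of the Porous Medium Equation from a large-time measurement. -/
theorem gamma_stability_core (γ τ₀ T c D ε α : ℝ)
    (hγ : 1 < γ) (hτ₀ : 0 < τ₀) (hT : 0 ≤ T) (hc : 0 < c) (hD : 0 ≤ D)
    (hε0 : 0 < ε) (hε1 : ε < 1)
    (hεlb : c * (τ₀ + T) ^ (-(1 / (γ - 1))) ≤ ε)
    (hα : 1 - 2 / Real.log ε < α) (hαγ : α ≤ γ)
    (hbound : |(γ - 1) * ε ^ γ - (α - 1) * ε ^ α|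
      ≤ D * (1 + T) ^ (-(2 + 1 / (γ - 1)))) :
    |γ - α| ≤ D / c ^ γ * (max τ₀ 1) ^ (γ / (γ - 1)) * (1 + T) ^ (-(1 : ℝ)) := by
  have hg : 0 < γ - 1 := by linarith
  have hlog : Real.log ε < 0 := Real.log_neg hε0 hε1
  have hd : 0 ≤ γ - α := by linarith
  have haL : 2 < (α - 1) * (-Real.log ε) := by
    have h1 : 2 / (-Real.log ε) < α - 1 := by rw [div_neg]; linarith
    rwa [div_lt_iff₀ (by linarith)] at h1
  have ha : 0 < α - 1 := by
    by_contra hcon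
    nlinarith
  have hεγ : 0 < ε ^ γ := Real.rpow_pos_of_pos hε0 _
  have hsplit : ε ^ α = ε ^ γ * Real.exp ((γ - α) * (-Real.log ε)) := by
    rw [Real.rpow_def_of_pos hε0, Real.rpow_def_of_pos hε0, ← Real.exp_add]
    congr 1; ring
  have hexp := Real.add_one_le_exp ((γ - α) * (-Real.log ε))
  have key : ε ^ γ * (γ - α) ≤ (α - 1) * ε ^ α - (γ - 1) * ε ^ γ := by
    rw [hsplit]
    have h1 : γ - α ≤ (α - 1) * Real.exp ((γ - α) * (-Real.log ε)) - (γ - 1) := by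
      have h2 := mul_le_mul_of_nonneg_left hexp ha.le
      have h3 := mul_le_mul_of_nonneg_left haL.le hd
      nlinarith
    have h4 := mul_le_mul_of_nonneg_left h1 hεγ.le
    nlinarith
  have key2 : ε ^ γ * (γ - α) ≤ D * (1 + T) ^ (-(2 + 1 / (γ - 1))) := by
    refine le_trans ?_ hbound
    rw [abs_sub_comm]
    exact key.trans (le_abs_self _)
  have hM : 1 ≤ max τ₀ 1 := le_max_right _ _
  have hM2 : τ₀ ≤ max τ₀ 1 := le_max_left _ _
  generalize max τ₀ 1 = M at hM hM2 ⊢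
  have hM0 : 0 < M := by linarith
  have hT1 : 0 < 1 + T := by linarith
  have hq : γ / (γ - 1) = 1 + 1 / (γ - 1) := by field_simp; ring
  have hq0 : 0 < γ / (γ - 1) := by positivity
  have hcγ : 0 < c ^ γ := Real.rpow_pos_of_pos hc _
  have hMq : 0 < M ^ (γ / (γ - 1)) := Real.rpow_pos_of_pos hM0 _
  have hTq : 0 < (1 + T) ^ (γ / (γ - 1)) := Real.rpow_pos_of_pos hT1 _
  have low : c ^ γ / (M ^ (γ / (γ - 1)) * (1 + T) ^ (γ / (γ - 1))) ≤ ε ^ γ := by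
    have h1 : (c * (τ₀ + T) ^ (-(1 / (γ - 1)))) ^ γ ≤ ε ^ γ :=
      Real.rpow_le_rpow (by positivity) hεlb (by linarith)
    refine le_trans ?_ h1
    rw [Real.mul_rpow hc.le (by positivity), ← Real.rpow_mul (by positivity),
      show -(1 / (γ - 1)) * γ = -(γ / (γ - 1)) by ring, Real.rpow_neg (by positivity),
      ← div_eq_mul_inv, ← Real.mul_rpow hM0.le hT1.le]
    apply div_le_div_of_nonneg_left hcγ.le (by positivity)
    apply Real.rpow_le_rpow (by positivity) _ hq0.le
    nlinarith
  have hTs : (1 + T) ^ (-(2 + 1 / (γ - 1))) * (1 + T) ^ (γ / (γ - 1)) = (1 + T) ^ (-(1 : ℝ)) := by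
    rw [← Real.rpow_add hT1, hq]
    congr 1; ring
  rw [abs_of_nonneg hd, ← hTs]
  have h5 := (mul_le_mul_of_nonneg_right low hd).trans key2
  rw [div_mul_eq_mul_div, div_le_iff₀ (by positivity)] at h5
  rw [div_mul_eq_mul_div, div_mul_eq_mul_div, le_div_iff₀ hcγ]
  linarith
end

section
/- Let (Ω, μ) be a measure space, let O ⊆ Ω be measurable with 0 < μ(O) < ∞, let p ≥ 1 be a real number, and let u : Ω → ℝ be measurable. Let ε₀, ε₁ be real numbers with 0 < ε₀ and ε₁ < 1 such that ε₀ ≤ u(x) ≤ ε₁ for μ-almost every x ∈ O. Let α, γ be real numbers with α > 1 − 2/ln(ε₁) and γ > 1 − 2/ln(ε₁), and assume ∫_O |(γ−1)·u^γ − (α−1)·u^α|^p dμ < ∞. Then |γ − α| ≤ ε₀^(−max(α,γ))·(μ(O))^(−1/p)·(∫_O |(γ−1)·u(x)^γ − (α−1)·u(x)^α|^p dμ(x))^(1/p). -/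
open MeasureTheory Real

theorem aux_pointwise (t e α γ : ℝ) (he : 0 < e) (het : e ≤ t) (ht : t < 1)
    (hα : 2 < (α - 1) * (-Real.log t)) (h : α ≤ γ) :
    (γ - α) * e ^ γ ≤ (α - 1) * t ^ α - (γ - 1) * t ^ γ := by
  have ht0 : 0 < t := lt_of_lt_of_le he het
  have hL : 0 < -Real.log t := by
    have := Real.log_neg ht0 ht
    linarith
  have ha : 0 < α - 1 := by
    by_contra hc
    nlinarith
  have h1 : t ^ α = t ^ γ * Real.exp ((γ - α) * (-Real.log t)) := by
    rw [Real.rpow_def_of_pos ht0, Real.rpow_def_of_pos ht0, ← Real.exp_add]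
    congr 1
    ring
  have h2 := Real.add_one_le_exp ((γ - α) * (-Real.log t))
  have h3 : e ^ γ ≤ t ^ γ := Real.rpow_le_rpow he.le het (by linarith)
  have h4 : 0 < t ^ γ := Real.rpow_pos_of_pos ht0 γ
  have h5 : (γ - 1) + (γ - α) ≤ (α - 1) * Real.exp ((γ - α) * (-Real.log t)) := by
    have h6 := mul_le_mul_of_nonneg_left h2 ha.le
    have h7 := mul_le_mul_of_nonneg_left hα.le (sub_nonneg.2 h)
    nlinarith
  have h8 := mul_le_mul_of_nonneg_left h5 h4.le
  have h9 := mul_le_mul_of_nonneg_left h3 (sub_nonneg.2 h)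
  rw [h1]
  nlinarith

theorem aux_cond (t e₁ α : ℝ) (ht : 0 < t) (hte : t ≤ e₁) (he : e₁ < 1)
    (hα : 1 - 2 / Real.log e₁ < α) : 2 < (α - 1) * (-Real.log t) := by
  have h1 : Real.log e₁ < 0 := Real.log_neg (ht.trans_le hte) he
  have h2 : Real.log t ≤ Real.log e₁ := Real.log_le_log ht hte
  have h3 : 2 / (-Real.log e₁) < α - 1 := by
    rw [div_neg]
    linarith
  have h4 : 0 < -Real.log e₁ := by linarith
  have h5 : 0 < α - 1 := lt_trans (by positivity) h3
  rw [div_lt_iff₀ h4] at h3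
  nlinarith

theorem aux_abs (t e₀ e₁ α γ : ℝ) (he : 0 < e₀) (het : e₀ ≤ t) (hte : t ≤ e₁) (he₁ : e₁ < 1)
    (hα : 1 - 2 / Real.log e₁ < α) (hγ : 1 - 2 / Real.log e₁ < γ) :
    |γ - α| * e₀ ^ (max α γ) ≤ |(γ - 1) * t ^ γ - (α - 1) * t ^ α| := by
  have ht : 0 < t := he.trans_le het
  have ht1 : t < 1 := hte.trans_lt he₁
  rcases le_total α γ with h | h
  · rw [max_eq_right h, abs_of_nonneg (sub_nonneg.2 h), abs_sub_comm]
    exact (aux_pointwise t e₀ α γ he het ht1 (aux_cond t e₁ α ht hte he₁ hα) h).trans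
      (le_abs_self _)
  · rw [max_eq_left h, abs_sub_comm γ α, abs_of_nonneg (sub_nonneg.2 h)]
    exact (aux_pointwise t e₀ γ α he het ht1 (aux_cond t e₁ γ ht hte he₁ hγ) h).trans
      (le_abs_self _)

/-- L^p stability estimate for recovering the polytropic exponent `γ` of the
Porous Medium Equation (core of Corollary 3.6). -/
theorem lp_stability_estimate {Ω : Type*} [MeasurableSpace Ω] (μ : Measure Ω)
    (O : Set Ω) (hO : MeasurableSet O) (hO0 : 0 < μ O) (hOfin : μ O < ⊤)
    (p : ℝ) (hp : 1 ≤ p) (u : Ω → ℝ) (hu : Measurable u)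
    (ε₀ ε₁ : ℝ) (hε₀ : 0 < ε₀) (hε₁ : ε₁ < 1)
    (hbd : ∀ᵐ x ∂μ.restrict O, ε₀ ≤ u x ∧ u x ≤ ε₁)
    (α γ : ℝ) (hα : 1 - 2 / Real.log ε₁ < α) (hγ : 1 - 2 / Real.log ε₁ < γ)
    (hint : IntegrableOn
      (fun x => |(γ - 1) * u x ^ γ - (α - 1) * u x ^ α| ^ p) O μ) :
    |γ - α| ≤ ε₀ ^ (-(max α γ)) * (μ O).toReal ^ (-(1 / p)) *
      (∫ x in O, |(γ - 1) * u x ^ γ - (α - 1) * u x ^ α| ^ p ∂μ) ^ (1 / p) := by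
  have hp0 : 0 < p := by linarith
  have hm : 0 < (μ O).toReal := ENNReal.toReal_pos hO0.ne' hOfin.ne
  set M := max α γ with hM
  have hE : 0 < ε₀ ^ M := Real.rpow_pos_of_pos hε₀ M
  have hc : 0 ≤ |γ - α| * ε₀ ^ M := by positivity
  have hI : (|γ - α| * ε₀ ^ M) ^ p * (μ O).toReal ≤
      ∫ x in O, |(γ - 1) * u x ^ γ - (α - 1) * u x ^ α| ^ p ∂μ := by
    have h1 : ∫ x in O, (|γ - α| * ε₀ ^ M) ^ p ∂μ ≤
        ∫ x in O, |(γ - 1) * u x ^ γ - (α - 1) * u x ^ α| ^ p ∂μ := by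
      apply integral_mono_ae _ hint
      · filter_upwards [hbd] with x hx
        exact Real.rpow_le_rpow hc
          (aux_abs (u x) ε₀ ε₁ α γ hε₀ hx.1 hx.2 hε₁ hα hγ) hp0.le
      · exact integrableOn_const hOfin.ne
    rw [setIntegral_const, smul_eq_mul, mul_comm] at h1
    exact h1
  have hR := Real.rpow_le_rpow (by positivity) hI (by positivity : 0 ≤ 1 / p)
  rw [Real.mul_rpow (by positivity) hm.le, ← Real.rpow_mul hc, mul_one_div_cancel hp0.ne',
    Real.rpow_one] at hR
  have hm' : 0 < (μ O).toReal ^ (1 / p) := Real.rpow_pos_of_pos hm _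
  rw [Real.rpow_neg hε₀.le, Real.rpow_neg hm.le]
  calc |γ - α| = (ε₀ ^ M)⁻¹ * ((μ O).toReal ^ (1 / p))⁻¹ *
        (|γ - α| * ε₀ ^ M * (μ O).toReal ^ (1 / p)) := by
        field_simp
    _ ≤ _ := mul_le_mul_of_nonneg_left hR (by positivity)
end

section
/- Let (Ω, μ) be a measure space with μ(Ω) < ∞, let T ≥ 0, let u : Ω → ℝ be measurable with 0 ≤ u(x) ≤ 1 for μ-almost every x ∈ Ω, and let w : Ω → ℝ be integrable. Then the function G : (1, ∞) → ℝ defined by G(α) = ∫_Ω |(α−1)·(1+T)·u(x)^α − w(x)| dμ(x) is continuous on (1, ∞). -/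
open MeasureTheory Real

/-- Continuity in `α` of the L¹-norm of `F(α) = (α-1)(1+T)·u^α - w` on `(1, ∞)`,
when `0 ≤ u ≤ 1` a.e. on a finite measure space. -/
theorem continuousOn_l1_norm_F {Ω : Type*} [MeasurableSpace Ω] (μ : Measure Ω)
    (hμ : μ Set.univ < ⊤) (T : ℝ) (hT : 0 ≤ T)
    (u : Ω → ℝ) (hu : Measurable u) (hu01 : ∀ᵐ x ∂μ, 0 ≤ u x ∧ u x ≤ 1)
    (w : Ω → ℝ) (hw : Integrable w μ) :
    ContinuousOn (fun α : ℝ => ∫ x, |(α - 1) * (1 + T) * u x ^ α - w x| ∂μ)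
      (Set.Ioi 1) := by
  haveI : IsFiniteMeasure μ := ⟨hμ⟩
  intro a ha
  have ha1 : (1 : ℝ) < a := ha
  apply ContinuousAt.continuousWithinAt
  apply continuousAt_of_dominated (bound := fun x => a * (1 + T) + |w x|)
  · refine Filter.Eventually.of_forall fun α => ?_
    have h1 : Measurable fun x => (α - 1) * (1 + T) * u x ^ α :=
      (hu.pow_const α).const_mul _
    exact (h1.aestronglyMeasurable.sub hw.aestronglyMeasurable).norm
  · filter_upwards [Ioo_mem_nhds ha1 (lt_add_one a)] with α hα
    filter_upwards [hu01] with x hx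
    have h0 : 0 ≤ u x ^ α := Real.rpow_nonneg hx.1 α
    have h1 : u x ^ α ≤ 1 := Real.rpow_le_one hx.1 hx.2 (by linarith [hα.1])
    have hα1 : 0 ≤ α - 1 := by linarith [hα.1]
    have hα2 : α - 1 ≤ a := by linarith [hα.2]
    have hc : 0 ≤ (α - 1) * (1 + T) := mul_nonneg hα1 (by linarith)
    have h2 : (α - 1) * (1 + T) * u x ^ α ≤ a * (1 + T) :=
      (mul_le_of_le_one_right hc h1).trans
        (mul_le_mul_of_nonneg_right hα2 (by linarith))
    rw [Real.norm_eq_abs, abs_abs]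
    refine (abs_sub _ _).trans ?_
    rw [abs_of_nonneg (mul_nonneg hc h0)]
    linarith
  · exact (integrable_const _).add hw.abs
  · refine Filter.Eventually.of_forall fun x => ?_
    have h1 : ContinuousAt (fun α : ℝ => u x ^ α) a :=
      Real.continuousAt_const_rpow' (by linarith)
    have h2 : ContinuousAt (fun α : ℝ => (α - 1) * (1 + T)) a := by fun_prop
    exact ((h2.mul h1).sub continuousAt_const).abs
end

section
/- Let Ω be a nonempty topological space and let X = C_b(Ω, ℝ) be the space of bounded continuous real-valued functions on Ω with the sup norm ‖·‖. Let γ > 1, T ≥ 0, and C₀, K, B ≥ 0 be real numbers. Let L : X → X be a continuous linear map with operator norm at most C₀, and let f, u_T, h ∈ X satisfy: (i) f(x) ≥ 0 and u_T(x) > 0 for all x ∈ Ω; (ii) (1+T)^(−1/(γ−1))·f = u_T + h (as functions); (iii) L(f) = (γ−1)·f^γ, where f^γ ∈ X is the pointwise power x ↦ f(x)^γ; (iv) ‖h‖ ≤ K·(1+T)^(−1 − 1/(γ−1)); (v) ‖u_T‖ ≤ B·(1+T)^(−1/(γ−1)). Then ‖(γ−1)·u_T^γ − (1+T)^(−1)·L(u_T)‖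 ≤ (C₀·K + γ·(γ−1)·(B+K)^(γ−1)·K)·(1+T)^(−2 − 1/(γ−1)). -/
open Real BoundedContinuousFunction

theorem aux_rpow_lip (γ M x y : ℝ) (hγ : 1 < γ) (hx : 0 ≤ x) (hxM : x ≤ M)
    (hy : 0 ≤ y) (hyM : y ≤ M) :
    |x ^ γ - y ^ γ| ≤ γ * M ^ (γ - 1) * |x - y| := by
  have := Convex.norm_image_sub_le_of_norm_hasDerivWithin_le (𝕜 := ℝ)
    (f := fun t : ℝ => t ^ γ) (f' := fun t => γ * t ^ (γ - 1)) (s := Set.Icc 0 M)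
    (C := γ * M ^ (γ - 1)) (x := y) (y := x)
    (fun t _ => (Real.hasDerivAt_rpow_const (Or.inr hγ.le)).hasDerivWithinAt)
    (fun t ht => by
      have h0 : 0 ≤ t ^ (γ - 1) := Real.rpow_nonneg ht.1 _
      rw [Real.norm_of_nonneg (by positivity)]
      exact mul_le_mul_of_nonneg_left
        (Real.rpow_le_rpow ht.1 ht.2 (by linarith)) (by linarith))
    (convex_Icc 0 M) ⟨hy, hyM⟩ ⟨hx, hxM⟩
  simpa [Real.norm_eq_abs] using this

/-- Abstract form of Proposition 3.1: the asymptotic estimate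
`‖(γ-1)·u_T^γ - (1+T)^{-1}·L(u_T)‖ ≲ (1+T)^{-2-1/(γ-1)}` in the sup norm,
where `L` plays the role of `(-Δ)^{-1}`. -/
theorem asymptotic_estimate_sup_norm {Ω : Type*} [TopologicalSpace Ω] [Nonempty Ω]
    (γ T C₀ K B : ℝ) (hγ : 1 < γ) (hT : 0 ≤ T)
    (hC₀ : 0 ≤ C₀) (hK : 0 ≤ K) (hB : 0 ≤ B)
    (L : (Ω →ᵇ ℝ) →L[ℝ] (Ω →ᵇ ℝ)) (hL : ‖L‖ ≤ C₀)
    (f uT h : Ω →ᵇ ℝ)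
    (hf : ∀ x, 0 ≤ f x) (huT : ∀ x, 0 < uT x)
    (hexp : (1 + T) ^ (-(1 / (γ - 1))) • f = uT + h)
    (fγ uTγ : Ω →ᵇ ℝ)
    (hfγ : ∀ x, fγ x = f x ^ γ) (huTγ : ∀ x, uTγ x = uT x ^ γ)
    (heig : L f = (γ - 1) • fγ)
    (hh : ‖h‖ ≤ K * (1 + T) ^ (-1 - 1 / (γ - 1)))
    (huTbd : ‖uT‖ ≤ B * (1 + T) ^ (-(1 / (γ - 1)))) :
    ‖(γ - 1) • uTγ - (1 + T) ^ (-(1 : ℝ)) • L uT‖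
      ≤ (C₀ * K + γ * (γ - 1) * (B + K) ^ (γ - 1) * K)
        * (1 + T) ^ (-2 - 1 / (γ - 1)) := by
  have hs : 0 < 1 + T := by linarith
  have hg : γ - 1 ≠ 0 := by linarith
  have e1 : (1 + T) ^ (-1 - 1 / (γ - 1))
      = (1 + T) ^ (-(1 : ℝ)) * (1 + T) ^ (-(1 / (γ - 1))) := by
    rw [← Real.rpow_add hs]; ring_nf
  have e2 : (1 + T) ^ (-2 - 1 / (γ - 1))
      = (1 + T) ^ (-(1 : ℝ)) * ((1 + T) ^ (-(1 : ℝ)) * (1 + T) ^ (-(1 / (γ - 1)))) := by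
    rw [← Real.rpow_add hs, ← Real.rpow_add hs]; ring_nf
  have e3 : ((1 + T) ^ (-(1 / (γ - 1)))) ^ (γ - 1) = (1 + T) ^ (-(1 : ℝ)) := by
    rw [← Real.rpow_mul hs.le]; congr 1; field_simp
  have e4 : ((1 + T) ^ (-(1 / (γ - 1)))) ^ γ
      = (1 + T) ^ (-(1 : ℝ)) * (1 + T) ^ (-(1 / (γ - 1))) := by
    rw [← Real.rpow_mul hs.le, ← Real.rpow_add hs]; congr 1; field_simp; ring
  have hq1 : (1 + T) ^ (-(1 : ℝ)) ≤ 1 :=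
    Real.rpow_le_one_of_one_le_of_nonpos (by linarith) (by norm_num)
  have hq0 : 0 < (1 + T) ^ (-(1 : ℝ)) := Real.rpow_pos_of_pos hs _
  have ha0 : 0 < (1 + T) ^ (-(1 / (γ - 1))) := Real.rpow_pos_of_pos hs _
  rw [e1] at hh
  rw [e2]
  generalize (1 + T) ^ (-(1 : ℝ)) = q at *
  generalize (1 + T) ^ (-(1 / (γ - 1))) = a at *
  have hLu : L uT = (a * (γ - 1)) • fγ - L h := by
    have : uT = a • f - h := by rw [hexp]; simp
    rw [this, map_sub, map_smul, heig, smul_smul]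
  have hnn : 0 ≤ (C₀ * K + γ * (γ - 1) * (B + K) ^ (γ - 1) * K) := by
    have : 0 ≤ γ - 1 := by linarith
    have : 0 ≤ γ := by linarith
    positivity
  rw [BoundedContinuousFunction.norm_le (by positivity)]
  intro x
  have hx : a * f x = uT x + h x := by
    have := congrArg (fun g : Ω →ᵇ ℝ => g x) hexp
    simpa using this
  have hLh : |L h x| ≤ C₀ * (K * (q * a)) := by
    calc |L h x| ≤ ‖L h‖ := (L h).norm_coe_le_norm x
      _ ≤ ‖L‖ * ‖h‖ := L.le_opNorm h
      _ ≤ _ := mul_le_mul hL hh (norm_nonneg _) hC₀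
  have hhx : |h x| ≤ K * (q * a) := (h.norm_coe_le_norm x).trans hh
  have hux : uT x ≤ B * a := (le_abs_self _).trans ((uT.norm_coe_le_norm x).trans huTbd)
  have hKa : K * (q * a) ≤ K * a :=
    mul_le_mul_of_nonneg_left (by nlinarith) hK
  have hKa0 : 0 ≤ K * a := by positivity
  have hlip := aux_rpow_lip γ ((B + K) * a) (uT x) (a * f x) hγ (huT x).le
    (by linarith) (mul_nonneg ha0.le (hf x))
    (by rw [hx]; linarith [le_abs_self (h x)])
  rw [Real.mul_rpow (by positivity) ha0.le, e3, Real.mul_rpow ha0.le (hf x), e4,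
    show uT x - a * f x = -h x by rw [hx]; ring, abs_neg] at hlip
  have key : ((γ - 1) • uTγ - q • L uT) x
      = (γ - 1) * (uT x ^ γ - q * a * f x ^ γ) + q * L h x := by
    rw [hLu]
    simp [hfγ, huTγ]
    ring
  rw [key, Real.norm_eq_abs]
  have hP : 0 ≤ (B + K) ^ (γ - 1) := by positivity
  have hg0 : 0 ≤ γ - 1 := by linarith
  have hγ0 : 0 ≤ γ := by linarith
  calc _ ≤ |(γ - 1) * (uT x ^ γ - q * a * f x ^ γ)| + |q * L h x| := abs_add_le _ _
    _ = (γ - 1) * |uT x ^ γ - q * a * f x ^ γ| + q * |L h x| := by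
      rw [abs_mul, abs_mul, abs_of_nonneg hg0, abs_of_pos hq0]
    _ ≤ (γ - 1) * (γ * ((B + K) ^ (γ - 1) * q) * (K * (q * a))) + q * (C₀ * (K * (q * a))) := by
      gcongr
      exact hlip.trans (by gcongr)
    _ = _ := by ring
end

section
/- Let (Ω, μ) be a measure space with μ(Ω) < ∞, let O ⊆ Ω be measurable with 0 < μ(O), let T ≥ 0, τ₀ > 0, c > 0, D ≥ 0 be real numbers, and let u : Ω → ℝ be measurable with 0 ≤ u a.e. on Ω and bounded, and let w : Ω → ℝ be integrable. Let ε₀, ε₁ be real numbers with c·(τ₀+T)^(−1/(γ−1)) ≤ ε₀ and ε₁ < 1 such that ε₀ ≤ u(x) ≤ ε₁ for μ-almost every x ∈ O. Let γ, γ_m be real numbers with γ > 1 − 2/ln(ε₁) and γ_m > 1 − 2/ln(ε₁). Define N(α) := ∫_Ω |(α−1)·u(x)^α − w(x)/(1+T)| dμ(x). If N(γ) ≤ D·(1+T)^(−(2 + 1/(γ−1))) and N(γ_m) ≤ N(γ), then |γ − γ_m| ≤ 2·D·ε₀^(−max(γ,γ_m))·(μ(O))^(−1)·(1+T)^(−(2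 + 1/(γ−1))). -/
open MeasureTheory Real

lemma aux_pt (x e a b : ℝ) (hx : 0 < x) (hxe : x ≤ e) (he : e < 1)
    (ha : 1 - 2 / Real.log e < a) (hab : a ≤ b) :
    x ^ b * (b - a) ≤ (a - 1) * x ^ a - (b - 1) * x ^ b := by
  have hle : Real.log e < 0 := Real.log_neg (hx.trans_le hxe) he
  have hlx : Real.log x ≤ Real.log e := Real.log_le_log hx hxe
  have h1 : 0 < a - 1 := by
    have : 2 / Real.log e < 0 := div_neg_of_pos_of_neg two_pos hle
    linarith
  have h2 : 2 ≤ (a - 1) * (-Real.log x) := by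
    have h3 : 2 / (-Real.log e) ≤ a - 1 := by
      rw [div_neg]; linarith
    rw [div_le_iff₀ (by linarith)] at h3
    nlinarith
  have h4 : x ^ a = x ^ b * Real.exp ((b - a) * (-Real.log x)) := by
    rw [Real.rpow_def_of_pos hx, Real.rpow_def_of_pos hx, ← Real.exp_add]
    congr 1; ring
  have h5 := Real.add_one_le_exp ((b - a) * (-Real.log x))
  have h6 : 0 < x ^ b := Real.rpow_pos_of_pos hx b
  rw [h4]
  have h7 : b - a ≤ (a - 1) * Real.exp ((b - a) * (-Real.log x)) - (b - 1) := by
    have h8 := mul_le_mul_of_nonneg_left h5 h1.le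
    have h9 := mul_le_mul_of_nonneg_left h2 (sub_nonneg.2 hab)
    nlinarith
  have := mul_le_mul_of_nonneg_left h7 h6.le
  linarith

lemma aux_abs_s15 (x e d a b : ℝ) (hd : 0 < d) (hx : d ≤ x) (hxe : x ≤ e) (he : e < 1)
    (ha : 1 - 2 / Real.log e < a) (hb : 1 - 2 / Real.log e < b) :
    d ^ (max a b) * |a - b| ≤ |(a - 1) * x ^ a - (b - 1) * x ^ b| := by
  have hle : Real.log e < 0 := Real.log_neg (hd.trans_le (hx.trans hxe)) he
  have h0 : 2 / Real.log e < 0 := div_neg_of_pos_of_neg two_pos hle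
  rcases le_total a b with h | h
  · rw [max_eq_right h, abs_sub_comm a b, abs_of_nonneg (sub_nonneg.2 h)]
    refine le_trans ?_ ((aux_pt x e a b (hd.trans_le hx) hxe he ha h).trans (le_abs_self _))
    exact mul_le_mul_of_nonneg_right (Real.rpow_le_rpow hd.le hx (by linarith)) (sub_nonneg.2 h)
  · rw [max_eq_left h, abs_of_nonneg (sub_nonneg.2 h), abs_sub_comm]
    refine le_trans ?_ ((aux_pt x e b a (hd.trans_le hx) hxe he hb h).trans (le_abs_self _))
    exact mul_le_mul_of_nonneg_right (Real.rpow_le_rpow hd.le hx (by linarith)) (sub_nonneg.2 h)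

/-- Abstract quantitative form of Proposition 4.2: if `γ` solves the inverse
Porous Medium problem (satisfying the asymptotic L¹ estimate) and `γ_m` is a
minimizer of the functional of Algorithm IP, then `|γ - γ_m| ≲ (1+T)^{-(2+1/(γ-1))}`. -/
theorem gamma_minimizer_estimate {Ω : Type*} [MeasurableSpace Ω] (μ : Measure Ω)
    (hμ : μ Set.univ < ⊤) (O : Set Ω) (hO : MeasurableSet O) (hO0 : 0 < μ O)
    (T τ₀ c D : ℝ) (hT : 0 ≤ T) (hτ₀ : 0 < τ₀) (hc : 0 < c) (hD : 0 ≤ D)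
    (u : Ω → ℝ) (hu : Measurable u) (hu0 : ∀ᵐ x ∂μ, 0 ≤ u x)
    (hubdd : ∃ M : ℝ, ∀ x, |u x| ≤ M)
    (w : Ω → ℝ) (hw : Integrable w μ)
    (γ γm ε₀ ε₁ : ℝ)
    (hε₀ : c * (τ₀ + T) ^ (-(1 / (γ - 1))) ≤ ε₀) (hε₁ : ε₁ < 1)
    (hbd : ∀ᵐ x ∂μ.restrict O, ε₀ ≤ u x ∧ u x ≤ ε₁)
    (hγ : 1 - 2 / Real.log ε₁ < γ) (hγm : 1 - 2 / Real.log ε₁ < γm)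
    (N : ℝ → ℝ)
    (hN : ∀ α, N α = ∫ x, |(α - 1) * u x ^ α - w x / (1 + T)| ∂μ)
    (hNγ : N γ ≤ D * (1 + T) ^ (-(2 + 1 / (γ - 1))))
    (hNγm : N γm ≤ N γ) :
    |γ - γm| ≤ 2 * D * ε₀ ^ (-(max γ γm)) * (μ O).toReal⁻¹
      * (1 + T) ^ (-(2 + 1 / (γ - 1))) := by
  haveI : IsFiniteMeasure μ := ⟨hμ⟩
  have hd : 0 < ε₀ := lt_of_lt_of_le
    (mul_pos hc (Real.rpow_pos_of_pos (by linarith) _)) hε₀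
  have hne : (ae (μ.restrict O)).NeBot := by
    rw [ae_neBot]
    intro h
    rw [Measure.restrict_eq_zero] at h
    exact hO0.ne' h
  obtain ⟨x₀, hx₀⟩ := hbd.exists
  have hle : Real.log ε₁ < 0 := Real.log_neg (hd.trans_le (hx₀.1.trans hx₀.2)) hε₁
  have h0 : 2 / Real.log ε₁ < 0 := div_neg_of_pos_of_neg two_pos hle
  obtain ⟨M, hM⟩ := hubdd
  have hint : ∀ α : ℝ, 0 ≤ α → Integrable (fun x => (α - 1) * u x ^ α) μ := by
    intro α hα
    refine Integrable.const_mul ?_ _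
    refine Integrable.of_bound (hu.pow_const α).aestronglyMeasurable (M ^ α) ?_
    filter_upwards with x
    rw [Real.norm_eq_abs]
    exact (Real.abs_rpow_le_abs_rpow _ _).trans (Real.rpow_le_rpow (abs_nonneg _) (hM x) hα)
  have hi1 := hint γ (by linarith)
  have hi2 := hint γm (by linarith)
  have hw' := hw.div_const (1 + T)
  have hj1 := (hi1.sub hw').abs
  have hj2 := (hi2.sub hw').abs
  have hdiff := (hi1.sub hi2).abs
  have hA : ∫ x, |(γ - 1) * u x ^ γ - (γm - 1) * u x ^ γm| ∂μ ≤ N γ + N γm := by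
    rw [hN, hN]
    refine le_trans ?_ (integral_add hj1 hj2).le
    refine integral_mono hdiff (hj1.add hj2) ?_
    intro x
    have := abs_sub_le ((γ - 1) * u x ^ γ) (w x / (1 + T)) ((γm - 1) * u x ^ γm)
    rw [abs_sub_comm (w x / (1 + T))] at this
    exact this
  have hB : ∫ x in O, |(γ - 1) * u x ^ γ - (γm - 1) * u x ^ γm| ∂μ
      ≤ ∫ x, |(γ - 1) * u x ^ γ - (γm - 1) * u x ^ γm| ∂μ :=
    setIntegral_le_integral hdiff (Filter.Eventually.of_forall fun x => abs_nonneg _)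
  have hC : (μ O).toReal * (ε₀ ^ (max γ γm) * |γ - γm|)
      ≤ ∫ x in O, |(γ - 1) * u x ^ γ - (γm - 1) * u x ^ γm| ∂μ := by
    have : ∫ x in O, (ε₀ ^ (max γ γm) * |γ - γm|) ∂μ
        ≤ ∫ x in O, |(γ - 1) * u x ^ γ - (γm - 1) * u x ^ γm| ∂μ := by
      refine integral_mono_ae (integrable_const _) hdiff.integrableOn ?_
      filter_upwards [hbd] with x hx
      exact aux_abs_s15 _ ε₁ _ _ _ hd hx.1 hx.2 hε₁ hγ hγm
    rw [setIntegral_const, smul_eq_mul] at this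
    exact this
  have hm : 0 < (μ O).toReal := ENNReal.toReal_pos hO0.ne' (measure_ne_top μ O)
  have hp : 0 < ε₀ ^ (max γ γm) := Real.rpow_pos_of_pos hd _
  rw [Real.rpow_neg hd.le (max γ γm)]
  have hfin : (μ O).toReal * (ε₀ ^ (max γ γm) * |γ - γm|)
      ≤ 2 * (D * (1 + T) ^ (-(2 + 1 / (γ - 1)))) := by linarith
  have hk : |γ - γm| ≤ (2 * (D * (1 + T) ^ (-(2 + 1 / (γ - 1)))))
      / ((μ O).toReal * ε₀ ^ (max γ γm)) := by
    rw [le_div_iff₀ (mul_pos hm hp)]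
    linarith
  refine hk.trans (le_of_eq ?_)
  rw [div_eq_mul_inv, mul_inv]
  ring
end

section
/- Let 0 < ε < 1 and let g : ℝ → ℝ be a function, and let y₀ ∈ ℝ. Suppose g is continuous at y₀, g(y₀) > η_ε, and f_ε(g(y)) = y for all y in some neighborhood of y₀. Then g is differentiable at y₀, y₀ ≠ 0, 1 + (g(y₀) − 1)·ln(ε) ≠ 0, and g'(y₀) = (g(y₀) − 1) / ( y₀·(1 + (g(y₀) − 1)·ln(ε)) ). -/
open Real

/-- Derivative formula for a local inverse `g` of `f_ε(x) = (x-1)·ε^x`: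
`g'(y₀) = (g(y₀) - 1)/(y₀·(1 + (g(y₀)-1)·ln ε))`. -/
theorem deriv_local_inverse_f_eps (ε : ℝ) (hε0 : 0 < ε) (hε1 : ε < 1)
    (g : ℝ → ℝ) (y₀ : ℝ) (hcont : ContinuousAt g y₀)
    (hg : 1 - 1 / Real.log ε < g y₀)
    (hinv : ∀ᶠ y in nhds y₀, (g y - 1) * ε ^ (g y) = y) :
    y₀ ≠ 0 ∧ 1 + (g y₀ - 1) * Real.log ε ≠ 0 ∧
      HasDerivAt g ((g y₀ - 1) / (y₀ * (1 + (g y₀ - 1) * Real.log ε))) y₀ := by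
  have hL : Real.log ε < 0 := Real.log_neg hε0 hε1
  have hy : (g y₀ - 1) * ε ^ (g y₀) = y₀ := hinv.self_of_nhds
  have hP : 0 < ε ^ (g y₀) := Real.rpow_pos_of_pos hε0 _
  have hinvL : 1 / Real.log ε < 0 := one_div_neg.mpr hL
  have hg1 : 0 < g y₀ - 1 := by linarith
  have hD : 1 + (g y₀ - 1) * Real.log ε < 0 := by
    have h1 : -(1 / Real.log ε) < g y₀ - 1 := by linarith
    have h2 := mul_lt_mul_of_neg_right h1 hL
    have h3 : -(1 / Real.log ε) * Real.log ε = -1 := by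
      have := hL.ne
      field_simp
    linarith
  have hy0 : 0 < y₀ := by
    rw [← hy]
    exact mul_pos hg1 hP
  refine ⟨hy0.ne', hD.ne, ?_⟩
  have hf : HasDerivAt (fun x : ℝ => (x - 1) * ε ^ x)
      (ε ^ (g y₀) * (1 + (g y₀ - 1) * Real.log ε)) (g y₀) := by
    have h1 : HasDerivAt (fun x : ℝ => x - 1) 1 (g y₀) := (hasDerivAt_id _).sub_const 1
    have h2 : HasDerivAt (fun x : ℝ => ε ^ x) (ε ^ (g y₀) * Real.log ε) (g y₀) :=
      (Real.hasStrictDerivAt_const_rpow hε0 (g y₀)).hasDerivAt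
    refine (h1.mul h2).congr_deriv ?_
    ring
  have hmain := HasDerivAt.of_local_left_inverse hcont hf (mul_ne_zero hP.ne' hD.ne) hinv
  refine hmain.congr_deriv ?_
  have hDne := hD.ne
  have hPne := hP.ne'
  have hgne := hg1.ne'
  have hyne := hy0.ne'
  rw [inv_eq_one_div, div_eq_div_iff (mul_ne_zero hPne hDne) (mul_ne_zero hyne hDne)]
  linear_combination (-(1 + (g y₀ - 1) * Real.log ε)) * hy
end
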